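/- Consistency: if G is a non-empty graph that is provable in GS, then its dual Ḡ is not provable in GS. -/

import Mathlib

namespace GSP

/-- Atoms: a propositional variable (coded by a natural number) with a polarity. -/
abbrev Atom := ℕ × Bool

/-- The dual atom. -/
def dualAtom (a : Atom) : Atom := (a.1, !a.2)

/-- A finite, simple, undirected graph whose vertices are labelled by atoms. -/
structure LGraph where
  V : Type
  [fintype : Fintype V]
  adj : V → V → Prop
  symm : ∀ {v w : V}, adj v w → adj w v
  irrefl : ∀ v : V, ¬ adj v v
  label : V → Atom

attribute [instance] LGraph.fintype

namespace LGraph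

/-- An isomorphism of labelled graphs: a vertex bijection preserving labels and
preserving and reflecting edges. -/
structure Iso (G H : LGraph) where
  toEquiv : G.V ≃ H.V
  adj_iff : ∀ v w : G.V, G.adj v w ↔ H.adj (toEquiv v) (toEquiv w)
  label_eq : ∀ v : G.V, H.label (toEquiv v) = G.label v

/-- `G ≅ H` : the graphs `G` and `H` are isomorphic. -/
def iso (G H : LGraph) : Prop := Nonempty (Iso G H)

/-- The empty graph. -/
def empty : LGraph where
  V := Empty
  adj _ _ := False
  symm h := h.elim
  irrefl v := v.elim
  label v := v.elim

/-- The single-vertex graph labelled by the atom `a`. -/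
def single (a : Atom) : LGraph where
  V := Unit
  adj _ _ := False
  symm h := h.elim
  irrefl _ h := h
  label _ := a

def parAdj (G H : LGraph) : G.V ⊕ H.V → G.V ⊕ H.V → Prop
  | .inl a, .inl b => G.adj a b
  | .inr a, .inr b => H.adj a b
  | _, _ => False

/-- The par `G ⅋ H` : disjoint union of `G` and `H`. -/
def par (G H : LGraph) : LGraph where
  V := G.V ⊕ H.V
  adj := parAdj G H
  symm := by
    rintro (a | a) (b | b) h
    · exact G.symm h
    · exact h.elim
    · exact h.elim
    · exact H.symm h
  irrefl := by
    rintro (a | a) h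
    · exact G.irrefl a h
    · exact H.irrefl a h
  label := Sum.elim G.label H.label

def tensorAdj (G H : LGraph) : G.V ⊕ H.V → G.V ⊕ H.V → Prop
  | .inl a, .inl b => G.adj a b
  | .inr a, .inr b => H.adj a b
  | .inl _, .inr _ => True
  | .inr _, .inl _ => True

/-- The tensor `G ⊗ H` : join of `G` and `H` (disjoint union plus all edges in between). -/
def tensor (G H : LGraph) : LGraph where
  V := G.V ⊕ H.V
  adj := tensorAdj G H
  symm := by
    rintro (a | a) (b | b) h
    · exact G.symm h
    · exact trivial
    · exact trivial
    · exact H.symm h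
  irrefl := by
    rintro (a | a) h
    · exact G.irrefl a h
    · exact H.irrefl a h
  label := Sum.elim G.label H.label

/-- The dual graph `Ḡ` : same vertices, complemented edges, dualized labels. -/
def dual (G : LGraph) : LGraph where
  V := G.V
  adj v w := v ≠ w ∧ ¬ G.adj v w
  symm h := ⟨fun e => h.1 e.symm, fun h' => h.2 (G.symm h')⟩
  irrefl _ h := h.1 rfl
  label v := dualAtom (G.label v)

def plugAdj (C : LGraph) (R : Set C.V) (X : LGraph) : C.V ⊕ X.V → C.V ⊕ X.V → Prop
  | .inl a, .inl b => C.adj a b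
  | .inr a, .inr b => X.adj a b
  | .inl a, .inr _ => a ∈ R
  | .inr _, .inl b => b ∈ R

/-- `C[X]_R` : the graph obtained from the context `C[·]_R` by inserting the graph `X`
as a module whose vertices are adjacent exactly to the vertices in `R`. -/
def plug (C : LGraph) (R : Set C.V) (X : LGraph) : LGraph where
  V := C.V ⊕ X.V
  adj := plugAdj C R X
  symm := by
    rintro (a | a) (b | b) h
    · exact C.symm h
    · exact h
    · exact h
    · exact X.symm h
  irrefl := by
    rintro (a | a) h
    · exact C.irrefl a h
    · exact X.irrefl a h
  label := Sum.elim C.label X.label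

def compAdj (G : LGraph) (H : G.V → LGraph) :
    (Σ v : G.V, (H v).V) → (Σ v : G.V, (H v).V) → Prop := fun x y =>
  (∃ (v : G.V) (a b : (H v).V), x = ⟨v, a⟩ ∧ y = ⟨v, b⟩ ∧ (H v).adj a b) ∨
    (x.1 ≠ y.1 ∧ G.adj x.1 y.1)

/-- The composition `G⟨H v₁, …, H vₙ⟩` of the family `H` via the graph `G`:
replace each vertex `v` of `G` by the graph `H v`. -/
def comp (G : LGraph) (H : G.V → LGraph) : LGraph where
  V := Σ v : G.V, (H v).V
  adj := compAdj G H
  symm := by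
    rintro x y (⟨v, a, b, hx, hy, hab⟩ | ⟨hne, hadj⟩)
    · exact Or.inl ⟨v, b, a, hy, hx, (H v).symm hab⟩
    · exact Or.inr ⟨hne.symm, G.symm hadj⟩
  irrefl := by
    rintro ⟨v, a⟩ (⟨w, x, y, hx, hy, hxy⟩ | ⟨hne, _⟩)
    · have h := hx.symm.trans hy
      obtain rfl : x = y := by simpa using h
      exact (H w).irrefl x hxy
    · exact hne rfl
  label x := (H x.1).label x.2

/-- A module of `G` : a set `M` of vertices such that every vertex outside `M`
is adjacent either to all vertices of `M` or to none of them. -/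
def IsModule (G : LGraph) (M : Set G.V) : Prop :=
  ∀ v ∉ M, ∀ x ∈ M, ∀ y ∈ M, (G.adj v x ↔ G.adj v y)

/-- A prime graph: at least 2 vertices and only trivial modules. -/
def Prime (G : LGraph) : Prop :=
  2 ≤ Fintype.card G.V ∧
    ∀ M : Set G.V, G.IsModule M → M = ∅ ∨ (∃ v, M = {v}) ∨ M = Set.univ

/-- `G` is `P₄`-free: no four distinct vertices induce a path on 4 vertices. -/
def P4Free (G : LGraph) : Prop :=
  ¬ ∃ v₁ v₂ v₃ v₄ : G.V,
      v₁ ≠ v₂ ∧ v₁ ≠ v₃ ∧ v₁ ≠ v₄ ∧ v₂ ≠ v₃ ∧ v₂ ≠ v₄ ∧ v₃ ≠ v₄ ∧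
      G.adj v₁ v₂ ∧ G.adj v₂ v₃ ∧ G.adj v₃ v₄ ∧
      ¬ G.adj v₁ v₃ ∧ ¬ G.adj v₁ v₄ ∧ ¬ G.adj v₂ v₄

end LGraph

open LGraph

/-- The `n`-fold tensor `X₁ ⊗ ⋯ ⊗ Xₙ`. -/
def bigTensor : (n : ℕ) → (Fin n → LGraph) → LGraph
  | 0, _ => LGraph.empty
  | n + 1, F => (F 0).tensor (bigTensor n fun i => F i.succ)

/-- The `n`-fold par `X₁ ⅋ ⋯ ⅋ Xₙ`. -/
def bigPar : (n : ℕ) → (Fin n → LGraph) → LGraph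
  | 0, _ => LGraph.empty
  | n + 1, F => (F 0).par (bigPar n fun i => F i.succ)

/-- The inference rules of system GS (premise, conclusion). -/
inductive GSRule : LGraph → LGraph → Prop
  /-- ai↓ : premise `∅`, conclusion `ā ⅋ a`. -/
  | ai (a : Atom) : GSRule LGraph.empty ((single (dualAtom a)).par (single a))
  /-- ss↓ : premise `B[A]_S`, conclusion `B ⅋ A`, for `A ≠ ∅` and `S ≠ ∅`. -/
  | ss (A B : LGraph) (S : Set B.V) :
      Nonempty A.V → S ≠ ∅ → GSRule (B.plug S A) (B.par A)
  /-- p↓ : premise `(M₁ ⅋ N₁) ⊗ ⋯ ⊗ (Mₙ ⅋ Nₙ)`, conclusion `P̄⟨M₁,…,Mₙ⟩ ⅋ P⟨N₁,…,Nₙ⟩`,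
  for `P` prime with `n = |V(P)| ≥ 4` and all `Mᵢ ≠ ∅`. -/
  | p (n : ℕ) (P : LGraph) (e : P.V ≃ Fin n) (M N : Fin n → LGraph) :
      P.Prime → 4 ≤ n → (∀ i, Nonempty (M i).V) →
      GSRule (bigTensor n fun i => (M i).par (N i))
        ((P.dual.comp fun v => M (e v)).par (P.comp fun v => N (e v)))

/-- The "up" rules ai↑, ss↑, p↑ (premise, conclusion). -/
inductive UpRule : LGraph → LGraph → Prop
  /-- ai↑ : premise `a ⊗ ā`, conclusion `∅`. -/
  | ai (a : Atom) : UpRule ((single a).tensor (single (dualAtom a))) LGraph.empty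
  /-- ss↑ : premise `B ⊗ A`, conclusion `B[A]_S`, for `A ≠ ∅` and `S ≠ V(B)`. -/
  | ss (A B : LGraph) (S : Set B.V) :
      Nonempty A.V → S ≠ Set.univ → UpRule (B.tensor A) (B.plug S A)
  /-- p↑ : premise `P⟨M₁,…,Mₙ⟩ ⊗ P̄⟨N₁,…,Nₙ⟩`, conclusion `(M₁ ⊗ N₁) ⅋ ⋯ ⅋ (Mₙ ⊗ Nₙ)`,
  for `P` prime with `n = |V(P)| ≥ 4` and all `Mᵢ ≠ ∅`. -/
  | p (n : ℕ) (P : LGraph) (e : P.V ≃ Fin n) (M N : Fin n → LGraph) :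
      P.Prime → 4 ≤ n → (∀ i, Nonempty (M i).V) →
      UpRule ((P.comp fun v => M (e v)).tensor (P.dual.comp fun v => N (e v)))
        (bigPar n fun i => (M i).tensor (N i))

/-- The rules of system SGS : the rules of GS together with their duals. -/
def SGSRule (G H : LGraph) : Prop := GSRule G H ∨ UpRule G H

/-- A single inference step in a system: inside some context, replace a module
isomorphic to the premise of a rule by the corresponding conclusion. -/
def Step (Rules : LGraph → LGraph → Prop) (G H : LGraph) : Prop :=
  ∃ (C : LGraph) (R : Set C.V) (p c : LGraph),
    Rules p c ∧ G.iso (C.plug R p) ∧ H.iso (C.plug R c)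

/-- A derivation in a system from `G` to `H` : a finite sequence of inference steps
and isomorphisms leading from `G` to `H`. -/
def Deriv (Rules : LGraph → LGraph → Prop) (G H : LGraph) : Prop :=
  Relation.ReflTransGen (fun X Y => X.iso Y ∨ Step Rules X Y) G H

/-- A graph is provable in a system if there is a derivation from `∅` to it. -/
def Provable (Rules : LGraph → LGraph → Prop) (G : LGraph) : Prop :=
  Deriv Rules LGraph.empty G

/-- Formulas: unit, positive and negative atoms, par and tensor. -/
inductive Formula where
  | unit : Formula
  | pos (a : ℕ) : Formula
  | neg (a : ℕ) : Formula
  | par (φ ψ : Formula) : Formula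
  | tens (φ ψ : Formula) : Formula

/-- The graph `[φ]` of a formula `φ`. -/
def Formula.graph : Formula → LGraph
  | .unit => LGraph.empty
  | .pos a => single (a, true)
  | .neg a => single (a, false)
  | .par φ ψ => φ.graph.par ψ.graph
  | .tens φ ψ => φ.graph.tensor ψ.graph

/-- Structural equivalence of formulas: the smallest congruence making `⅋` and `⊗`
associative and commutative with unit `∘`. -/
inductive Formula.equiv : Formula → Formula → Prop
  | refl (φ) : Formula.equiv φ φ
  | symm {φ ψ} : Formula.equiv φ ψ → Formula.equiv ψ φ
  | trans {φ ψ χ} : Formula.equiv φ ψ → Formula.equiv ψ χ → Formula.equiv φ χ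
  | parComm (φ ψ) : Formula.equiv (.par φ ψ) (.par ψ φ)
  | parAssoc (φ ψ χ) : Formula.equiv (.par φ (.par ψ χ)) (.par (.par φ ψ) χ)
  | parUnit (φ) : Formula.equiv (.par φ .unit) φ
  | tensComm (φ ψ) : Formula.equiv (.tens φ ψ) (.tens ψ φ)
  | tensAssoc (φ ψ χ) : Formula.equiv (.tens φ (.tens ψ χ)) (.tens (.tens φ ψ) χ)
  | tensUnit (φ) : Formula.equiv (.tens φ .unit) φ
  | parCongr {φ φ' ψ ψ'} : Formula.equiv φ φ' → Formula.equiv ψ ψ' →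
      Formula.equiv (.par φ ψ) (.par φ' ψ')
  | tensCongr {φ φ' ψ ψ'} : Formula.equiv φ φ' → Formula.equiv ψ ψ' →
      Formula.equiv (.tens φ ψ) (.tens φ' ψ')

/-- A formula is unit-free if it contains no occurrence of the unit `∘`. -/
def Formula.UnitFree : Formula → Prop
  | .unit => False
  | .pos _ => True
  | .neg _ => True
  | .par φ ψ => φ.UnitFree ∧ ψ.UnitFree
  | .tens φ ψ => φ.UnitFree ∧ ψ.UnitFree

/-- The sequent calculus MLL° (multiplicative linear logic with mix) on multisets
of formulas. -/
inductive MLL : Multiset Formula → Prop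
  | ax (a : ℕ) : MLL {Formula.pos a, Formula.neg a}
  | tens {Γ Δ : Multiset Formula} (φ ψ : Formula) :
      MLL (φ ::ₘ Γ) → MLL (ψ ::ₘ Δ) → MLL (Formula.tens φ ψ ::ₘ (Γ + Δ))
  | par {Γ : Multiset Formula} (φ ψ : Formula) :
      MLL (φ ::ₘ ψ ::ₘ Γ) → MLL (Formula.par φ ψ ::ₘ Γ)
  | mix {Γ Δ : Multiset Formula} : MLL Γ → MLL Δ → MLL (Γ + Δ)

section Kappa
open Classical

/-- `M` is a module of the subgraph induced on `S`. -/
def IsMod {α : Type} (G : SimpleGraph α) (S M : Finset α) : Prop :=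
  M ⊆ S ∧ ∀ v ∈ S, v ∉ M → ∀ x ∈ M, ∀ y ∈ M, (G.Adj v x ↔ G.Adj v y)

/-- A nontrivial module of the subgraph induced on `S`. -/
def IsNT {α : Type} (G : SimpleGraph α) (S M : Finset α) : Prop :=
  IsMod G S M ∧ 2 ≤ M.card ∧ M.card < S.card

lemma card_rep {α : Type} {S M : Finset α} {m : α} (hMS : M ⊆ S) (hm : m ∈ M) :
    (insert m (S \ M)).card + M.card = S.card + 1 := by
  have h1 : m ∉ S \ M := by simp [hm]
  rw [Finset.card_insert_of_notMem h1, Finset.card_sdiff_of_subset hMS]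
  have := Finset.card_le_card hMS
  omega

/-- The numerical invariant of the induced subgraph on `S`: additive along modules, `1` on an
edge, `-1` on a non-edge, and the midpoint of the values of all one-vertex deletions on
prime graphs with at least three vertices. -/
noncomputable def kap {α : Type} (G : SimpleGraph α) (S : Finset α) : ℝ :=
  if h : ∃ p : Finset α × α, IsNT G S p.1 ∧ p.2 ∈ p.1 then
    kap G (insert h.choose.2 (S \ h.choose.1)) + kap G h.choose.1
  else if S.card ≤ 1 then 0
  else if S.card = 2 then (if ∃ x ∈ S, ∃ y ∈ S, G.Adj x y then 1 else -1)
  else ((⨆ v : {x // x ∈ S}, kap G (S.erase v.1)) + (⨅ v : {x // x ∈ S}, kap G (S.erase v.1))) / 2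
termination_by S.card
decreasing_by
  · have h1 := h.choose_spec
    have h2 := card_rep h1.1.1.1 h1.2
    have := h1.1.2
    omega
  · exact h.choose_spec.1.2.2
  · exact Finset.card_erase_lt_of_mem v.2
  · exact Finset.card_erase_lt_of_mem v.2

lemma kap_nt {α : Type} (G : SimpleGraph α) (S : Finset α) (h : ∃ M, IsNT G S M) :
    ∃ M m, IsNT G S M ∧ m ∈ M ∧ kap G S = kap G (insert m (S \ M)) + kap G M := by
  have h' : ∃ p : Finset α × α, IsNT G S p.1 ∧ p.2 ∈ p.1 := by
    obtain ⟨M, hM⟩ := h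
    have : M.Nonempty := by
      rw [← Finset.card_pos]
      have := hM.2.1
      omega
    obtain ⟨m, hm⟩ := this
    exact ⟨(M, m), hM, hm⟩
  refine ⟨h'.choose.1, h'.choose.2, h'.choose_spec.1, h'.choose_spec.2, ?_⟩
  rw [kap, dif_pos h']

lemma kap_prime {α : Type} (G : SimpleGraph α) (S : Finset α) (h : ¬ ∃ M, IsNT G S M) :
    kap G S = if S.card ≤ 1 then 0
      else if S.card = 2 then (if ∃ x ∈ S, ∃ y ∈ S, G.Adj x y then 1 else -1)
      else ((⨆ v : {x // x ∈ S}, kap G (S.erase v.1)) +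
        (⨅ v : {x // x ∈ S}, kap G (S.erase v.1))) / 2 := by
  have h' : ¬ ∃ p : Finset α × α, IsNT G S p.1 ∧ p.2 ∈ p.1 := fun ⟨p, hp⟩ => h ⟨p.1, hp.1⟩
  rw [kap, dif_neg h']

lemma kap_small {α : Type} (G : SimpleGraph α) (S : Finset α) (h : S.card ≤ 1) :
    kap G S = 0 := by
  rw [kap_prime, if_pos h]
  rintro ⟨M, hM⟩
  have := hM.2
  omega

lemma kap_two {α : Type} (G : SimpleGraph α) (S : Finset α) (h : S.card = 2) :
    kap G S = (if ∃ x ∈ S, ∃ y ∈ S, G.Adj x y then 1 else -1) := by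
  rw [kap_prime, if_neg (by omega), if_pos h]
  rintro ⟨M, hM⟩
  have := hM.2
  omega

/-- Additivity along modules, for sets of cardinality `n`. -/
def AddAt (n : ℕ) : Prop :=
  ∀ (α : Type) (G : SimpleGraph α) (S M : Finset α) (m : α), S.card = n → IsMod G S M → m ∈ M →
    kap G S = kap G (insert m (S \ M)) + kap G M

/-- Isomorphism invariance, for sets of cardinality `n`. -/
def IsoAt (n : ℕ) : Prop :=
  ∀ (α β : Type) (G : SimpleGraph α) (H : SimpleGraph β) (S : Finset α) (f : α → β), S.card = n →
    Set.InjOn f S → (∀ x ∈ S, ∀ y ∈ S, (G.Adj x y ↔ H.Adj (f x) (f y))) →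
    kap H (S.image f) = kap G S

lemma rep_indep {n : ℕ} (hI : ∀ k < n, IsoAt k) {α : Type} (G : SimpleGraph α) (S M : Finset α)
    (m m' : α) (hS : S.card = n) (hM : IsNT G S M) (hm : m ∈ M) (hm' : m' ∈ M) :
    kap G (insert m (S \ M)) = kap G (insert m' (S \ M)) := by
  have hc := card_rep hM.1.1 hm
  have h2 := hM.2
  have key := hI (insert m (S \ M)).card (by omega) α α G G (insert m (S \ M))
    (fun x => if x = m then m' else x) rfl ?_ ?_
  · rw [← key]
    refine congrArg (kap G) (Eq.symm ?_)
    ext x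
    simp only [Finset.mem_insert, Finset.mem_sdiff, Finset.mem_image]
    constructor
    · rintro (rfl | h)
      · exact ⟨m, Or.inl rfl, by simp⟩
      · exact ⟨x, Or.inr h, by rw [if_neg]; rintro rfl; exact h.2 hm⟩
    · rintro ⟨y, (rfl | h), rfl⟩
      · simp
      · right
        rw [if_neg (by rintro rfl; exact h.2 hm)]
        exact h
  · intro x hx y hy hxy
    simp only [Finset.coe_insert, Set.mem_insert_iff, Finset.mem_coe, Finset.mem_sdiff] at hx hy
    dsimp only at hxy
    split_ifs at hxy <;> grind
  · have hmod := hM.1.2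
    have hsub := hM.1.1
    intro x hx y hy
    simp only [Finset.mem_insert, Finset.mem_sdiff] at hx hy
    have a1 : ∀ z, z ∈ S → z ∉ M → z ≠ m := fun z _ h2 h => h2 (h ▸ hm)
    rcases hx with rfl | hx <;> rcases hy with rfl | hy
    · simp
    · simp only [if_true, if_neg (a1 y hy.1 hy.2)]
      rw [G.adj_comm x y, G.adj_comm m' y]
      exact hmod y hy.1 hy.2 _ hm _ hm'
    · simp only [if_true, if_neg (a1 x hx.1 hx.2)]
      exact hmod x hx.1 hx.2 _ hm _ hm'
    · simp only [if_neg (a1 x hx.1 hx.2), if_neg (a1 y hy.1 hy.2)]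

/-- Two modules give the same value. -/
def SameVal {α : Type} (G : SimpleGraph α) (S M N : Finset α) : Prop :=
  ∀ m ∈ M, ∀ n ∈ N, kap G (insert m (S \ M)) + kap G M = kap G (insert n (S \ N)) + kap G N

lemma SameVal.symm {α : Type} {G : SimpleGraph α} {S M N : Finset α} (h : SameVal G S M N) :
    SameVal G S N M := fun m hm n hn => (h n hn m hm).symm

lemma SameVal.trans {α : Type} {G : SimpleGraph α} {S M N L : Finset α} (h : SameVal G S M N)
    (h' : SameVal G S N L) (hN : N.Nonempty) : SameVal G S M L := fun m hm l hl => by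
  obtain ⟨n, hn⟩ := hN
  exact (h m hm n hn).trans (h' n hn l hl)

lemma nested_same {n : ℕ} (hA : ∀ k < n, AddAt k) (hI : ∀ k < n, IsoAt k) {α : Type}
    (G : SimpleGraph α) (S M N : Finset α) (hS : S.card = n) (hM : IsNT G S M) (hN : IsNT G S N)
    (hMN : M ⊆ N) : SameVal G S M N := by
  intro m hm n' hn'
  rw [← rep_indep hI G S N m n' hS hN (hMN hm) hn']
  have hc := card_rep hM.1.1 hm
  have h1 := hM.2
  have h2 := hN.2
  have e1 := hA N.card (by omega) α G N M m rfl
    ⟨hMN, fun v hv hvM => hM.1.2 v (hN.1.1 hv) hvM⟩ hm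
  have e2 := hA (insert m (S \ M)).card (by omega) α G (insert m (S \ M)) (insert m (N \ M)) m rfl
    ⟨Finset.insert_subset_insert _ (Finset.sdiff_subset_sdiff hN.1.1 (Finset.Subset.refl _)), by
      intro v hv hv' x hx y hy
      have hvS : v ∈ S := by
        have := hM.1.1 hm
        simp only [Finset.mem_insert, Finset.mem_sdiff] at hv
        rcases hv with rfl | hv
        · exact this
        · exact hv.1
      have hvN : v ∉ N := by
        simp only [Finset.mem_insert, Finset.mem_sdiff] at hv hv'
        tauto
      have hh : ∀ x ∈ insert m (N \ M), x ∈ N := by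
        intro x hx
        simp only [Finset.mem_insert, Finset.mem_sdiff] at hx
        rcases hx with rfl | hx
        · exact hMN hm
        · exact hx.1
      exact hN.1.2 v hvS hvN x (hh x hx) y (hh y hy)⟩ (by simp)
  have e3 : insert m (insert m (S \ M) \ insert m (N \ M)) = insert m (S \ N) := by
    ext x
    simp only [Finset.mem_insert, Finset.mem_sdiff]
    have := @hMN x
    tauto
  rw [e3] at e2
  rw [e1, e2]
  ring

lemma disjoint_same {n : ℕ} (hA : ∀ k < n, AddAt k) {α : Type}
    (G : SimpleGraph α) (S M N : Finset α) (hS : S.card = n) (hM : IsNT G S M) (hN : IsNT G S N)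
    (hMN : ∀ x ∈ M, x ∉ N) : SameVal G S M N := by
  have aux : ∀ (M N : Finset α), IsNT G S M → IsNT G S N → (∀ x ∈ M, x ∉ N) → ∀ m ∈ M, ∀ k ∈ N,
      kap G (insert m (S \ M)) = kap G (insert k (insert m (S \ M) \ N)) + kap G N := by
    intro M N hM hN hMN m hm k hk
    have hc := card_rep hM.1.1 hm
    have h1 := hM.2
    refine hA (insert m (S \ M)).card (by omega) α G _ N k rfl ⟨?_, ?_⟩ hk
    · intro x hx
      simp only [Finset.mem_insert, Finset.mem_sdiff]
      exact Or.inr ⟨hN.1.1 hx, fun h => hMN x h hx⟩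
    · intro v hv
      refine hN.1.2 v ?_
      simp only [Finset.mem_insert, Finset.mem_sdiff] at hv
      rcases hv with rfl | hv
      · exact hM.1.1 hm
      · exact hv.1
  intro m hm k hk
  rw [aux M N hM hN hMN m hm k hk, aux N M hN hM (fun x h h' => hMN x h' h) k hk m hm]
  have : insert k (insert m (S \ M) \ N) = insert m (insert k (S \ N) \ M) := by
    have := hMN m hm
    have : k ∉ M := fun h => hMN k h hk
    ext x
    simp only [Finset.mem_insert, Finset.mem_sdiff]
    by_cases h1 : x = m <;> by_cases h2 : x = k <;> grind
  rw [this]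
  ring

lemma all_same {n : ℕ} (hA : ∀ k < n, AddAt k) (hI : ∀ k < n, IsoAt k) {α : Type}
    (G : SimpleGraph α) (S M N : Finset α) (hS : S.card = n) (hM : IsNT G S M)
    (hN : IsNT G S N) : SameVal G S M N := by
  by_cases hd : ∀ x ∈ M, x ∉ N
  · exact disjoint_same hA G S M N hS hM hN hd
  push Not at hd
  obtain ⟨b, hbM, hbN⟩ := hd
  have hbB : b ∈ M ∩ N := Finset.mem_inter.2 ⟨hbM, hbN⟩
  by_cases hB : 2 ≤ (M ∩ N).card
  · have hBnt : IsNT G S (M ∩ N) := by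
      refine ⟨⟨fun x hx => hM.1.1 (Finset.mem_inter.1 hx).1, ?_⟩, hB, ?_⟩
      · intro v hv hvB x hx y hy
        rw [Finset.mem_inter] at hx hy hvB
        by_cases hvM : v ∈ M
        · exact hN.1.2 v hv (fun h => hvB ⟨hvM, h⟩) x hx.2 y hy.2
        · exact hM.1.2 v hv hvM x hx.1 y hy.1
      · exact lt_of_le_of_lt (Finset.card_le_card Finset.inter_subset_left) hM.2.2
    exact ((nested_same hA hI G S _ M hS hBnt hM Finset.inter_subset_left).symm).trans
      (nested_same hA hI G S _ N hS hBnt hN Finset.inter_subset_right) ⟨b, hbB⟩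
  · have hB1 : ∀ x ∈ M, x ∈ N → x = b := by
      intro x hx hx'
      exact Finset.card_le_one.1 (by omega) x (Finset.mem_inter.2 ⟨hx, hx'⟩) b hbB
    by_cases hU : M ∪ N = S
    · intro m hm k hk
      rw [rep_indep hI G S M m b hS hM hm hbM, rep_indep hI G S N k b hS hN hk hbN]
      have e1 : insert b (S \ M) = N := by
        rw [← hU]
        ext x
        simp only [Finset.mem_insert, Finset.mem_sdiff, Finset.mem_union]
        constructor
        · rintro (rfl | h)
          · exact hbN
          · tauto
        · intro h
          have := hB1 x
          tauto
      have e2 : insert b (S \ N) = M := by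
        rw [← hU]
        ext x
        simp only [Finset.mem_insert, Finset.mem_sdiff, Finset.mem_union]
        constructor
        · rintro (rfl | h)
          · exact hbM
          · tauto
        · intro h
          have := hB1 x
          tauto
      rw [e1, e2, add_comm]
    · have hsub : M ∪ N ⊆ S := Finset.union_subset hM.1.1 hN.1.1
      have hUnt : IsNT G S (M ∪ N) := by
        refine ⟨⟨hsub, ?_⟩, ?_, ?_⟩
        · intro v hv hvU
          rw [Finset.mem_union, not_or] at hvU
          have key : ∀ x ∈ M ∪ N, (G.Adj v x ↔ G.Adj v b) := by
            intro x hx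
            rcases Finset.mem_union.1 hx with h | h
            · exact hM.1.2 v hv hvU.1 x h b hbM
            · exact hN.1.2 v hv hvU.2 x h b hbN
          intro x hx y hy
          rw [key x hx, key y hy]
        · exact le_trans hM.2.1 (Finset.card_le_card Finset.subset_union_left)
        · exact Finset.card_lt_card (Finset.ssubset_iff_subset_ne.2 ⟨hsub, hU⟩)
      exact (nested_same hA hI G S M _ hS hM hUnt Finset.subset_union_left).trans
        (nested_same hA hI G S N _ hS hN hUnt Finset.subset_union_right).symm
        ⟨b, Finset.mem_union_left _ hbM⟩

lemma addAt_step {n : ℕ} (hA : ∀ k < n, AddAt k) (hI : ∀ k < n, IsoAt k) : AddAt n := by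
  intro α G S M m hS hM hm
  by_cases h1 : M.card ≤ 1
  · have hMm : M = {m} := by
      ext x
      rw [Finset.mem_singleton]
      exact ⟨fun h => Finset.card_le_one.1 h1 x h m hm, fun h => h ▸ hm⟩
    rw [kap_small G M h1, add_zero, hMm]
    congr 1
    ext x
    have := hM.1 hm
    simp only [Finset.mem_insert, Finset.mem_sdiff, Finset.mem_singleton]
    by_cases hx : x = m
    · subst hx; simpa using this
    · simp [hx]
  by_cases h2 : M = S
  · subst h2
    rw [kap_small G (insert m (M \ M)) (by simp), zero_add]
  have hnt : IsNT G S M :=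
    ⟨hM, by omega, Finset.card_lt_card (Finset.ssubset_iff_subset_ne.2 ⟨hM.1, h2⟩)⟩
  obtain ⟨N, k, hN, hk, e⟩ := kap_nt G S ⟨M, hnt⟩
  rw [e]
  exact all_same hA hI G S N M hS hN hnt k hk m hm

lemma isoAt_step {n : ℕ} (hA : AddAt n) (hI : ∀ k < n, IsoAt k) : IsoAt n := by
  intro α β G H S f hS hf hadj
  have hcard : (S.image f).card = S.card := Finset.card_image_of_injOn hf
  have hfm : ∀ M ⊆ S, ∀ x ∈ S, (f x ∈ M.image f ↔ x ∈ M) := by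
    intro M hM x hx
    constructor
    · intro h
      obtain ⟨y, hy, e⟩ := Finset.mem_image.1 h
      exact hf (hM hy) hx e ▸ hy
    · exact Finset.mem_image_of_mem f
  have hpush : ∀ M, IsNT G S M → IsNT H (S.image f) (M.image f) := by
    intro M hM
    have hcM : (M.image f).card = M.card :=
      Finset.card_image_of_injOn (hf.mono (by exact_mod_cast hM.1.1))
    refine ⟨⟨Finset.image_subset_image hM.1.1, ?_⟩, by rw [hcM]; exact hM.2.1,
      by rw [hcM, hcard]; exact hM.2.2⟩
    intro v hv hvM x hx y hy
    obtain ⟨v, hv1, rfl⟩ := Finset.mem_image.1 hv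
    obtain ⟨x, hx1, rfl⟩ := Finset.mem_image.1 hx
    obtain ⟨y, hy1, rfl⟩ := Finset.mem_image.1 hy
    replace hv := hv1
    replace hx := hx1
    replace hy := hy1
    rw [← hadj v hv x (hM.1.1 hx), ← hadj v hv y (hM.1.1 hy)]
    exact hM.1.2 v hv (fun h => hvM (Finset.mem_image_of_mem f h)) x hx y hy
  by_cases hex : ∃ M, IsNT G S M
  · obtain ⟨M, m, hM, hm, e⟩ := kap_nt G S hex
    have hMS := hM.1.1
    have hc := card_rep hMS hm
    have h2 := hM.2
    rw [e, hA β H (S.image f) (M.image f) (f m) (by omega) (hpush M hM).1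
      (Finset.mem_image_of_mem f hm)]
    have hTS : insert m (S \ M) ⊆ S := by
      intro x hx
      simp only [Finset.mem_insert, Finset.mem_sdiff] at hx
      rcases hx with rfl | hx
      · exact hMS hm
      · exact hx.1
    have e1 := hI (insert m (S \ M)).card (by omega) α β G H (insert m (S \ M)) f rfl
      (hf.mono (by exact_mod_cast hTS)) (fun x hx y hy => hadj x (hTS hx) y (hTS hy))
    have e2 := hI M.card (by omega) α β G H M f rfl
      (hf.mono (by exact_mod_cast hMS)) (fun x hx y hy => hadj x (hMS hx) y (hMS hy))
    rw [← e1, ← e2]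
    congr 2
    ext y
    simp only [Finset.mem_insert, Finset.mem_sdiff]
    constructor
    · rintro (rfl | ⟨h, h'⟩)
      · exact Finset.mem_image_of_mem f (by simp)
      · obtain ⟨x, hx, rfl⟩ := Finset.mem_image.1 h
        rw [hfm M hMS x hx] at h'
        exact Finset.mem_image_of_mem f (by simp [hx, h'])
    · intro h
      obtain ⟨x, hx, rfl⟩ := Finset.mem_image.1 h
      simp only [Finset.mem_insert, Finset.mem_sdiff] at hx
      rcases hx with rfl | hx
      · exact Or.inl rfl
      · exact Or.inr ⟨Finset.mem_image_of_mem f hx.1, fun h => hx.2 ((hfm M hMS x hx.1).1 h)⟩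
  · have hex' : ¬ ∃ N, IsNT H (S.image f) N := by
      rintro ⟨N, hN⟩
      apply hex
      refine ⟨S.filter (fun x => f x ∈ N), ?_⟩
      have himg : (S.filter (fun x => f x ∈ N)).image f = N := by
        ext y
        simp only [Finset.mem_image, Finset.mem_filter]
        constructor
        · rintro ⟨x, hx, rfl⟩
          exact hx.2
        · intro hy
          obtain ⟨x, hx, rfl⟩ := Finset.mem_image.1 (hN.1.1 hy)
          exact ⟨x, ⟨hx, hy⟩, rfl⟩
      have hcN : N.card = (S.filter (fun x => f x ∈ N)).card := by
        conv_lhs => rw [← himg]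
        exact Finset.card_image_of_injOn (hf.mono (by exact_mod_cast Finset.filter_subset _ _))
      refine ⟨⟨Finset.filter_subset _ _, ?_⟩, by rw [← hcN]; exact hN.2.1,
        by rw [← hcN, ← hcard]; exact hN.2.2⟩
      intro v hv hvN x hx y hy
      simp only [Finset.mem_filter, not_and] at hx hy hvN
      rw [hadj v hv x hx.1, hadj v hv y hy.1]
      exact hN.1.2 (f v) (Finset.mem_image_of_mem f hv) (hvN hv) _ hx.2 _ hy.2
    rw [kap_prime G S hex, kap_prime H _ hex', hcard]
    have e3 : (∃ x ∈ S.image f, ∃ y ∈ S.image f, H.Adj x y) ↔ ∃ x ∈ S, ∃ y ∈ S, G.Adj x y := by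
      constructor
      · rintro ⟨x, hx, y, hy, h⟩
        obtain ⟨x, hx1, rfl⟩ := Finset.mem_image.1 hx
        obtain ⟨y, hy1, rfl⟩ := Finset.mem_image.1 hy
        replace hx := hx1
        replace hy := hy1
        exact ⟨x, hx, y, hy, (hadj x hx y hy).2 h⟩
      · rintro ⟨x, hx, y, hy, h⟩
        exact ⟨f x, Finset.mem_image_of_mem f hx, f y, Finset.mem_image_of_mem f hy,
          (hadj x hx y hy).1 h⟩
    have e4 : ∀ v : {x // x ∈ S}, kap H ((S.image f).erase (f v.1)) = kap G (S.erase v.1) := by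
      intro v
      rw [← hI (S.erase v.1).card (by rw [← hS]; exact Finset.card_erase_lt_of_mem v.2) α β G H
        (S.erase v.1) f rfl
        (hf.mono (by exact_mod_cast Finset.erase_subset _ _))
        (fun x hx y hy => hadj x (Finset.mem_of_mem_erase hx) y (Finset.mem_of_mem_erase hy))]
      congr 1
      ext y
      simp only [Finset.mem_erase, Finset.mem_image]
      constructor
      · rintro ⟨h, x, hx, rfl⟩
        exact ⟨x, ⟨fun e => h (by rw [e]), hx⟩, rfl⟩
      · rintro ⟨x, ⟨hne, hx⟩, rfl⟩
        exact ⟨fun e => hne (hf hx v.2 e), x, hx, rfl⟩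
    have hsurj : Function.Surjective
        (fun v : {x // x ∈ S} => (⟨f v.1, Finset.mem_image_of_mem f v.2⟩ : {x // x ∈ S.image f})) := by
      rintro ⟨y, hy⟩
      obtain ⟨x, hx, rfl⟩ := Finset.mem_image.1 hy
      exact ⟨⟨x, hx⟩, rfl⟩
    have e5 := hsurj.iSup_congr (f := fun v : {x // x ∈ S} => kap G (S.erase v.1))
      (g := fun v : {x // x ∈ S.image f} => kap H ((S.image f).erase v.1)) _ e4
    have e6 := hsurj.iInf_congr (f := fun v : {x // x ∈ S} => kap G (S.erase v.1))
      (g := fun v : {x // x ∈ S.image f} => kap H ((S.image f).erase v.1)) _ e4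
    rw [e5, e6]
    simp only [e3]

lemma add_iso_all (n : ℕ) : AddAt n ∧ IsoAt n := by
  induction n using Nat.strong_induction_on with
  | _ n ih =>
    have h := addAt_step (fun k hk => (ih k hk).1) (fun k hk => (ih k hk).2)
    exact ⟨h, isoAt_step h (fun k hk => (ih k hk).2)⟩

lemma kap_add {α : Type} (G : SimpleGraph α) {S M : Finset α} {m : α} (hM : IsMod G S M)
    (hm : m ∈ M) : kap G S = kap G (insert m (S \ M)) + kap G M :=
  (add_iso_all S.card).1 α G S M m rfl hM hm

lemma kap_iso {α β : Type} (G : SimpleGraph α) (H : SimpleGraph β) (S : Finset α) (f : α → β)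
    (hf : Set.InjOn f S) (h : ∀ x ∈ S, ∀ y ∈ S, (G.Adj x y ↔ H.Adj (f x) (f y))) :
    kap H (S.image f) = kap G S :=
  (add_iso_all S.card).2 α β G H S f rfl hf h

lemma kap_erase {α : Type} (G : SimpleGraph α) (n : ℕ) : ∀ (S : Finset α) (v : α), S.card = n →
    2 ≤ S.card → v ∈ S → |kap G S - kap G (S.erase v)| ≤ 1 := by
  induction n using Nat.strong_induction_on with
  | _ n ih =>
  intro S v hn h2 hv
  by_cases hex : ∃ M, IsNT G S M
  · obtain ⟨M, hM⟩ := hex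
    have hMc := hM.2
    by_cases hvM : v ∈ M
    · obtain ⟨m, hm, hmv⟩ := Finset.exists_mem_ne (show 1 < M.card by omega) v
      have hmE : m ∈ M.erase v := Finset.mem_erase.2 ⟨hmv, hm⟩
      have e2 : IsMod G (S.erase v) (M.erase v) := by
        refine ⟨Finset.erase_subset_erase v hM.1.1, ?_⟩
        intro w hw hwM x hx y hy
        simp only [Finset.mem_erase] at hw hwM hx hy
        exact hM.1.2 w hw.2 (fun h => hwM ⟨hw.1, h⟩) x hx.2 y hy.2
      have e3 : insert m (S.erase v \ M.erase v) = insert m (S \ M) := by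
        ext x
        simp only [Finset.mem_insert, Finset.mem_sdiff, Finset.mem_erase]
        by_cases hx : x = v
        · subst hx; simp [hvM]
        · simp [hx]
      rw [kap_add G hM.1 hm, kap_add G e2 hmE, e3, add_sub_add_left_eq_sub]
      exact ih M.card (by omega) M v rfl (by omega) hvM
    · obtain ⟨m, hm⟩ : M.Nonempty := by rw [← Finset.card_pos]; omega
      have hmv : m ≠ v := fun h => hvM (h ▸ hm)
      have e2 : IsMod G (S.erase v) M := by
        refine ⟨fun x hx => Finset.mem_erase.2 ⟨fun h => hvM (h ▸ hx), hM.1.1 hx⟩, ?_⟩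
        intro w hw
        exact hM.1.2 w (Finset.mem_of_mem_erase hw)
      have e3 : insert m (S.erase v \ M) = (insert m (S \ M)).erase v := by
        ext x
        simp only [Finset.mem_insert, Finset.mem_sdiff, Finset.mem_erase]
        by_cases hx : x = v
        · subst hx; simp [hmv.symm]
        · simp [hx]
      have hc := card_rep hM.1.1 hm
      rw [kap_add G hM.1 hm, kap_add G e2 hm, e3, add_sub_add_right_eq_sub]
      exact ih (insert m (S \ M)).card (by omega) _ v rfl (by omega) (by simp [hv, hvM])
  · by_cases h3 : S.card = 2
    · rw [kap_two G S h3, kap_small G (S.erase v) (by rw [Finset.card_erase_of_mem hv]; omega)]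
      split_ifs <;> norm_num
    · rw [kap_prime G S hex, if_neg (by omega), if_neg h3]
      have hne : Nonempty {x // x ∈ S} := ⟨⟨v, hv⟩⟩
      have hpair : ∀ a ∈ S, ∀ b ∈ S, kap G (S.erase a) ≤ kap G (S.erase b) + 2 := by
        intro a ha b hb
        by_cases hab : a = b
        · subst hab; linarith
        have ca := Finset.card_erase_of_mem ha
        have cb := Finset.card_erase_of_mem hb
        have h1 := ih _ (by omega) (S.erase a) b rfl (by omega)
          (Finset.mem_erase.2 ⟨Ne.symm hab, hb⟩)
        have h2 := ih _ (by omega) (S.erase b) a rfl (by omega)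
          (Finset.mem_erase.2 ⟨hab, ha⟩)
        rw [Finset.erase_right_comm] at h2
        rw [abs_le] at h1 h2
        linarith
      set g : {x // x ∈ S} → ℝ := fun v => kap G (S.erase v.1) with hg
      have b1 : BddAbove (Set.range g) := (Set.finite_range g).bddAbove
      have b2 : BddBelow (Set.range g) := (Set.finite_range g).bddBelow
      have s1 : g ⟨v, hv⟩ ≤ ⨆ i, g i := le_ciSup b1 ⟨v, hv⟩
      have s2 : ⨅ i, g i ≤ g ⟨v, hv⟩ := ciInf_le b2 ⟨v, hv⟩
      have s3 : ⨆ i, g i ≤ (⨅ i, g i) + 2 := by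
        refine ciSup_le fun i => ?_
        have : g i - 2 ≤ ⨅ j, g j := le_ciInf fun j => by
          have := hpair i.1 i.2 j.1 j.2
          simp only [hg]
          linarith
        linarith
      have s4 : g ⟨v, hv⟩ = kap G (S.erase v) := rfl
      rw [← s4, abs_le]
      constructor <;> linarith

lemma kap_subset {α : Type} (G : SimpleGraph α) (S T : Finset α) (hST : S ⊆ T)
    (hS : S.Nonempty) : |kap G T - kap G S| ≤ (T.card : ℝ) - S.card := by
  induction hn : T.card - S.card generalizing T with
  | zero =>
    have : S = T := Finset.eq_of_subset_of_card_le hST (by omega)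
    subst this
    simp
  | succ k ih =>
    have hne : ∃ v ∈ T, v ∉ S := by
      by_contra hcon
      push Not at hcon
      have := Finset.card_le_card (show T ⊆ S from hcon)
      omega
    obtain ⟨v, hvT, hvS⟩ := hne
    have hc := Finset.card_erase_of_mem hvT
    have hS0 := Finset.card_pos.2 hS
    have h1 := ih (T.erase v) (fun x hx => Finset.mem_erase.2 ⟨fun h => hvS (h ▸ hx), hST hx⟩)
      (by omega)
    have h2 := kap_erase G T.card T v rfl (by omega) hvT
    have hc' : (T.card : ℝ) = ((T.erase v).card : ℝ) + 1 := by
      rw [hc]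
      push_cast [show 1 ≤ T.card by omega]
      ring
    have := abs_sub_le (kap G T) (kap G (T.erase v)) (kap G S)
    linarith

lemma kap_compl {α : Type} (G : SimpleGraph α) (n : ℕ) : ∀ (S : Finset α), S.card = n →
    kap Gᶜ S = - kap G S := by
  induction n using Nat.strong_induction_on with
  | _ n ih =>
  intro S hn
  have hmod : ∀ M, IsMod Gᶜ S M ↔ IsMod G S M := by
    intro M
    refine and_congr_right fun hMS => ?_
    refine forall_congr' fun v => forall_congr' fun hv => forall_congr' fun hvM =>
      forall_congr' fun x => forall_congr' fun hx => forall_congr' fun y => forall_congr' fun hy => ?_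
    have h1 : v ≠ x := fun h => hvM (h ▸ hx)
    have h2 : v ≠ y := fun h => hvM (h ▸ hy)
    simp only [SimpleGraph.compl_adj, h1, h2, ne_eq, not_false_eq_true, true_and]
    exact not_iff_not
  have hnt : (∃ M, IsNT Gᶜ S M) ↔ ∃ M, IsNT G S M := by simp only [IsNT, hmod]
  by_cases hex : ∃ M, IsNT G S M
  · obtain ⟨M, m, hM, hm, e⟩ := kap_nt G S hex
    have hc := card_rep hM.1.1 hm
    have hMc := hM.2
    rw [e, kap_add Gᶜ ((hmod M).2 hM.1) hm, ih _ (by omega) (insert m (S \ M)) rfl,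
      ih _ (by omega) M rfl]
    ring
  · rw [kap_prime G S hex, kap_prime Gᶜ S (fun h => hex (hnt.1 h))]
    by_cases h1 : S.card ≤ 1
    · simp [h1]
    by_cases h2 : S.card = 2
    · rw [if_neg h1, if_neg h1, if_pos h2, if_pos h2]
      obtain ⟨x, y, hxy, rfl⟩ := Finset.card_eq_two.1 h2
      by_cases h : G.Adj x y
      · simp [h, G.adj_comm y x]
      · simp [h, G.adj_comm y x, hxy]
    · rw [if_neg h1, if_neg h1, if_neg h2, if_neg h2]
      have e : ∀ v : {x // x ∈ S}, kap Gᶜ (S.erase v.1) = - kap G (S.erase v.1) := fun v =>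
        ih _ (by rw [← hn]; exact Finset.card_erase_lt_of_mem v.2) _ rfl
      simp only [e]
      have hs : ∀ g : {x // x ∈ S} → ℝ, ⨆ v, - g v = - ⨅ v, g v := by
        intro g
        rw [iInf, Real.sInf_def, neg_neg, iSup]
        congr 1
        ext z
        simp [neg_eq_iff_eq_neg]
      have hs' : ∀ g : {x // x ∈ S} → ℝ, ⨅ v, - g v = - ⨆ v, g v := by
        intro g
        have := hs (fun v => - g v)
        simp only [neg_neg] at this
        linarith
      rw [hs, hs']
      ring

/-- Composition formula: `T` is partitioned into modules by the fibres of `π`. -/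
lemma kap_fibers {α β : Type} (G : SimpleGraph α) (H : SimpleGraph β) (π : β → α) (n : ℕ) :
    ∀ T : Finset β, T.card = n →
    (∀ x ∈ T, ∀ y ∈ T, π x ≠ π y → (H.Adj x y ↔ G.Adj (π x) (π y))) →
    kap H T = kap G (T.image π) + ∑ v ∈ T.image π, kap H (T.filter fun t => π t = v) := by
  induction n using Nat.strong_induction_on with
  | _ n ih =>
  intro T hn hadj
  by_cases hinj : Set.InjOn π T
  · have e1 : kap G (T.image π) = kap H T := by
      refine kap_iso H G T π hinj fun x hx y hy => ?_
      by_cases h : π x = π y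
      · have := hinj hx hy h
        subst this
        simp
      · exact hadj x hx y hy h
    rw [e1, Finset.sum_eq_zero, add_zero]
    intro v _
    apply kap_small
    rw [Finset.card_le_one]
    intro a ha b hb
    rw [Finset.mem_filter] at ha hb
    exact hinj ha.1 hb.1 (ha.2.trans hb.2.symm)
  · simp only [Set.InjOn, not_forall] at hinj
    obtain ⟨m, hm, m', hm', hpi, hne⟩ := hinj
    have hm : m ∈ T := hm
    have hm' : m' ∈ T := hm'
    set F := T.filter fun t => π t = π m with hF
    have hmF : m ∈ F := by simp [hF, hm]
    have hmF' : m' ∈ F := by simp [hF, hm', hpi]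
    have hFT : F ⊆ T := Finset.filter_subset _ _
    have hmod : IsMod H T F := by
      refine ⟨hFT, ?_⟩
      intro v hv hvF x hx y hy
      simp only [hF, Finset.mem_filter, not_and] at hx hy hvF
      rw [hadj v hv x hx.1 (by rw [hx.2]; exact hvF hv),
        hadj v hv y hy.1 (by rw [hy.2]; exact hvF hv), hx.2, hy.2]
    have hFc : 2 ≤ F.card := Finset.one_lt_card.2 ⟨m, hmF, m', hmF', hne⟩
    have hc := card_rep hFT hmF
    have hsub : insert m (T \ F) ⊆ T := by
      intro x hx
      rw [Finset.mem_insert, Finset.mem_sdiff] at hx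
      rcases hx with rfl | hx
      · exact hm
      · exact hx.1
    have e2 := ih _ (by omega) (insert m (T \ F)) rfl
      (fun x hx y hy => hadj x (hsub hx) y (hsub hy))
    have himg : (insert m (T \ F)).image π = T.image π := by
      ext v
      simp only [Finset.mem_image, Finset.mem_insert, Finset.mem_sdiff]
      constructor
      · rintro ⟨x, (rfl | hx), rfl⟩
        · exact ⟨x, hm, rfl⟩
        · exact ⟨x, hx.1, rfl⟩
      · rintro ⟨x, hx, rfl⟩
        by_cases h : x ∈ F
        · exact ⟨m, Or.inl rfl, (Finset.mem_filter.1 h).2.symm⟩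
        · exact ⟨x, Or.inr ⟨hx, h⟩, rfl⟩
    rw [himg] at e2
    rw [kap_add H hmod hmF, e2, add_assoc]
    congr 1
    have hpm : π m ∈ T.image π := Finset.mem_image_of_mem π hm
    rw [← Finset.add_sum_erase _ _ hpm, ← Finset.add_sum_erase (T.image π) _ hpm]
    have z1 : kap H ((insert m (T \ F)).filter fun t => π t = π m) = 0 := by
      apply kap_small
      rw [Finset.card_le_one]
      intro a ha b hb
      simp only [hF, Finset.mem_filter, Finset.mem_insert, Finset.mem_sdiff, not_and] at ha hb
      have ha1 : a = m := by tauto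
      have hb1 : b = m := by tauto
      rw [ha1, hb1]
    have z2 : ∑ v ∈ (T.image π).erase (π m), kap H ((insert m (T \ F)).filter fun t => π t = v) =
        ∑ v ∈ (T.image π).erase (π m), kap H (T.filter fun t => π t = v) := by
      refine Finset.sum_congr rfl fun v hv => ?_
      congr 1
      have hv1 := (Finset.mem_erase.1 hv).1
      ext x
      simp only [hF, Finset.mem_filter, Finset.mem_insert, Finset.mem_sdiff, not_and]
      constructor
      · rintro ⟨(rfl | h), h'⟩
        · exact ⟨hm, h'⟩
        · exact ⟨h.1, h'⟩
      · rintro ⟨h, h'⟩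
        exact ⟨Or.inr ⟨h, fun _ h2 => hv1 (h'.symm.trans h2)⟩, h'⟩
    rw [z1, z2]
    ring

end Kappa

section Final
open Classical

/-- The underlying simple graph of a labelled graph. -/
def LGraph.sg (G : LGraph) : SimpleGraph G.V where
  Adj := G.adj
  symm := ⟨fun _ _ h => G.symm h⟩
  loopless := ⟨G.irrefl⟩

/-- The numerical invariant of a labelled graph. -/
noncomputable def LGraph.K (G : LGraph) : ℝ := kap G.sg Finset.univ

lemma kap_image (G H : LGraph) (f : G.V → H.V) (hf : Function.Injective f)
    (h : ∀ x y, G.adj x y ↔ H.adj (f x) (f y)) : kap H.sg (Finset.univ.image f) = G.K :=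
  kap_iso G.sg H.sg Finset.univ f hf.injOn (fun x _ y _ => h x y)

lemma K_equiv (G H : LGraph) (e : G.V ≃ H.V)
    (h : ∀ x y, G.adj x y ↔ H.adj (e x) (e y)) : H.K = G.K := by
  rw [← kap_image G H e e.injective h, LGraph.K]
  congr 1
  ext x
  simp only [Finset.mem_univ, Finset.mem_image, true_and, true_iff]
  exact ⟨e.symm x, e.apply_symm_apply x⟩

lemma K_iso {G H : LGraph} (h : G.iso H) : H.K = G.K := by
  obtain ⟨e⟩ := h
  exact K_equiv G H e.toEquiv e.adj_iff

lemma K_dual (G : LGraph) : G.dual.K = - G.K := by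
  have h1 : G.dual.sg = G.sgᶜ := by
    apply SimpleGraph.ext
    funext x y
    exact propext (SimpleGraph.compl_adj G.sg x y).symm
  unfold LGraph.K
  rw [h1]
  exact kap_compl G.sg _ _ rfl

lemma K_empty (G : LGraph) (h : IsEmpty G.V) : G.K = 0 := by
  apply kap_small
  rw [Finset.univ_eq_empty]
  simp

/-- A generic one-vertex graph. -/
def pt : LGraph := single (0, true)

/-- Embedding of the context into a plugged graph. -/
def pinl (C : LGraph) (R : Set C.V) (X : LGraph) (a : C.V) : (C.plug R X).V := Sum.inl a

/-- Embedding of the inserted module into a plugged graph. -/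
def pinr (C : LGraph) (R : Set C.V) (X : LGraph) (a : X.V) : (C.plug R X).V := Sum.inr a

lemma pinl_inj (C : LGraph) (R : Set C.V) (X : LGraph) : Function.Injective (pinl C R X) :=
  Sum.inl_injective

lemma pinr_inj (C : LGraph) (R : Set C.V) (X : LGraph) : Function.Injective (pinr C R X) :=
  Sum.inr_injective

lemma pinl_ne (C : LGraph) (R : Set C.V) (X : LGraph) (a : C.V) (b : X.V) :
    pinl C R X a ≠ pinr C R X b := Sum.inl_ne_inr

lemma plug_cases (C : LGraph) (R : Set C.V) (X : LGraph) (z : (C.plug R X).V) :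
    (∃ a, z = pinl C R X a) ∨ ∃ b, z = pinr C R X b := by
  rcases z with z | z
  · exact Or.inl ⟨z, rfl⟩
  · exact Or.inr ⟨z, rfl⟩

/-- Replacing the point by a vertex of the module. -/
def pmap (C : LGraph) (R : Set C.V) (X : LGraph) (x : X.V) : (C.plug R pt).V → (C.plug R X).V :=
  fun z => Sum.elim (pinl C R X) (fun _ => pinr C R X x) z

lemma K_plug (C : LGraph) (R : Set C.V) (X : LGraph) (hX : Nonempty X.V) :
    (C.plug R X).K = (C.plug R pt).K + X.K := by
  obtain ⟨x⟩ := hX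
  have e1 : kap (C.plug R X).sg (Finset.univ.image (pinr C R X)) = X.K :=
    kap_image X (C.plug R X) (pinr C R X) (pinr_inj C R X) (fun _ _ => Iff.rfl)
  have e2 : kap (C.plug R X).sg (Finset.univ.image (pmap C R X x)) = (C.plug R pt).K := by
    refine kap_image (C.plug R pt) (C.plug R X) (pmap C R X x) ?_ ?_
    · rintro (a | a) (b | b) h
      · exact congrArg Sum.inl (pinl_inj C R X h)
      · exact absurd h (pinl_ne C R X _ _)
      · exact absurd h.symm (pinl_ne C R X _ _)
      · rfl
    · rintro (a | a) (b | b)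
      · exact Iff.rfl
      · exact Iff.rfl
      · exact Iff.rfl
      · exact iff_of_false (fun h => h) (X.irrefl x)
  have hmod : IsMod (C.plug R X).sg Finset.univ (Finset.univ.image (pinr C R X)) := by
    refine ⟨Finset.subset_univ _, ?_⟩
    intro v _ hvM a ha b hb
    obtain ⟨a, _, rfl⟩ := Finset.mem_image.1 ha
    obtain ⟨b, _, rfl⟩ := Finset.mem_image.1 hb
    rcases plug_cases C R X v with ⟨v, rfl⟩ | ⟨v, rfl⟩
    · exact Iff.rfl
    · exact absurd (Finset.mem_image_of_mem _ (Finset.mem_univ v)) hvM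
  have h := kap_add (C.plug R X).sg hmod (Finset.mem_image_of_mem _ (Finset.mem_univ x))
  rw [← e1, ← e2]
  refine h.trans ?_
  congr 2
  ext z
  simp only [Finset.mem_insert, Finset.mem_sdiff, Finset.mem_univ, true_and, Finset.mem_image]
  rcases plug_cases C R X z with ⟨z, rfl⟩ | ⟨z, rfl⟩
  · refine iff_of_true (Or.inr ?_) ⟨pinl C R pt z, rfl⟩
    rintro ⟨a, ha⟩
    exact pinl_ne C R X _ _ ha.symm
  · constructor
    · rintro (h | h)
      · exact ⟨pinr C R pt (), h.symm⟩
      · exact absurd ⟨z, rfl⟩ h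
    · rintro ⟨y, hy⟩
      rcases plug_cases C R pt y with ⟨y, rfl⟩ | ⟨y, rfl⟩
      · exact absurd hy (pinl_ne C R X _ _)
      · exact Or.inl hy.symm

lemma K_plug_pt (C : LGraph) (R : Set C.V) (hC : Nonempty C.V) :
    |(C.plug R pt).K - C.K| ≤ 1 := by
  obtain ⟨c⟩ := hC
  have e1 : kap (C.plug R pt).sg (Finset.univ.image (pinl C R pt)) = C.K :=
    kap_image C (C.plug R pt) (pinl C R pt) (pinl_inj C R pt) (fun _ _ => Iff.rfl)
  have e2 : (Finset.univ : Finset (C.plug R pt).V).erase (pinr C R pt ()) =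
      Finset.univ.image (pinl C R pt) := by
    ext z
    simp only [Finset.mem_erase, Finset.mem_univ, and_true, Finset.mem_image, true_and]
    rcases plug_cases C R pt z with ⟨z, rfl⟩ | ⟨z, rfl⟩
    · exact iff_of_true (pinl_ne C R pt _ _) ⟨z, rfl⟩
    · refine iff_of_false (fun h => h rfl) ?_
      rintro ⟨a, ha⟩
      exact pinl_ne C R pt _ _ ha
  rw [← e1, ← e2]
  refine kap_erase _ _ Finset.univ _ rfl ?_ (Finset.mem_univ _)
  exact Finset.one_lt_card.2 ⟨pinl C R pt c, Finset.mem_univ _, pinr C R pt (), Finset.mem_univ _,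
    pinl_ne C R pt _ _⟩

lemma K_par_plug (G H : LGraph) : (G.par H).K = (G.plug ∅ H).K := by
  refine K_equiv (G.plug ∅ H) (G.par H) (Equiv.refl _) ?_
  rintro (a | a) (b | b) <;> exact Iff.rfl

lemma K_tensor_plug (G H : LGraph) : (G.tensor H).K = (G.plug Set.univ H).K := by
  refine K_equiv (G.plug Set.univ H) (G.tensor H) (Equiv.refl _) ?_
  rintro (a | a) (b | b) <;> exact Iff.rfl

lemma K_par_comm (G H : LGraph) : (G.par H).K = (H.par G).K := by
  refine K_equiv (H.par G) (G.par H) (Equiv.sumComm _ _) ?_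
  rintro (a | a) (b | b) <;> exact Iff.rfl

lemma K_tensor_comm (G H : LGraph) : (G.tensor H).K = (H.tensor G).K := by
  refine K_equiv (H.tensor G) (G.tensor H) (Equiv.sumComm _ _) ?_
  rintro (a | a) (b | b) <;> exact Iff.rfl

lemma K_pt : pt.K = 0 := by
  apply kap_small
  exact (Finset.card_univ (α := Unit)).le

lemma card_sum_unit : (Finset.univ : Finset (Unit ⊕ Unit)).card = 2 := rfl

lemma K_par_pt : (pt.par pt).K = -1 := by
  unfold LGraph.K
  rw [kap_two, if_neg]
  · rintro ⟨x, -, y, -, h⟩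
    rcases x with x | x <;> rcases y with y | y <;> exact h
  · exact card_sum_unit

lemma K_tensor_pt : (pt.tensor pt).K = 1 := by
  unfold LGraph.K
  rw [kap_two, if_pos]
  · exact ⟨Sum.inl (), Finset.mem_univ _, Sum.inr (), Finset.mem_univ _, trivial⟩
  · exact card_sum_unit

lemma K_par (G H : LGraph) (hG : Nonempty G.V) (hH : Nonempty H.V) :
    (G.par H).K = G.K + H.K - 1 := by
  rw [K_par_plug, K_plug _ _ _ hH, ← K_par_plug, K_par_comm, K_par_plug, K_plug _ _ _ hG,
    ← K_par_plug, K_par_pt]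
  ring

lemma K_tensor (G H : LGraph) (hG : Nonempty G.V) (hH : Nonempty H.V) :
    (G.tensor H).K = G.K + H.K + 1 := by
  rw [K_tensor_plug, K_plug _ _ _ hH, ← K_tensor_plug, K_tensor_comm, K_tensor_plug,
    K_plug _ _ _ hG, ← K_tensor_plug, K_tensor_pt]
  ring

lemma K_plug_empty (C : LGraph) (R : Set C.V) (X : LGraph) (hX : IsEmpty X.V) :
    (C.plug R X).K = C.K := by
  refine K_equiv C (C.plug R X) (Equiv.sumEmpty C.V X.V).symm ?_
  intro x y
  exact Iff.rfl

lemma K_par_empty (G H : LGraph) (hH : IsEmpty H.V) : (G.par H).K = G.K := by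
  rw [K_par_plug, K_plug_empty _ _ _ hH]

lemma K_tensor_empty (G H : LGraph) (hH : IsEmpty H.V) : (G.tensor H).K = G.K := by
  rw [K_tensor_plug, K_plug_empty _ _ _ hH]

lemma bigTensor_nonempty : ∀ (n : ℕ) (F : Fin n → LGraph), 0 < n → (∀ i, Nonempty (F i).V) →
    Nonempty (bigTensor n F).V
  | 0, _, h, _ => absurd h (lt_irrefl 0)
  | _ + 1, _, _, hF => ⟨Sum.inl (hF 0).some⟩

lemma K_bigTensor (n : ℕ) : ∀ (F : Fin (n + 1) → LGraph), (∀ i, Nonempty (F i).V) →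
    (bigTensor (n + 1) F).K = ∑ i, (F i).K + n := by
  induction n with
  | zero =>
    intro F hF
    have : (bigTensor 1 F).K = (F 0).K := K_tensor_empty (F 0) LGraph.empty ⟨fun x => x.elim⟩
    rw [this]
    simp
  | succ n ih =>
    intro F hF
    have h1 : (bigTensor (n + 1 + 1) F).K =
        (F 0).K + (bigTensor (n + 1) fun i => F i.succ).K + 1 :=
      K_tensor _ _ (hF 0) (bigTensor_nonempty _ _ (Nat.succ_pos n) fun i => hF i.succ)
    rw [h1, ih _ (fun i => hF i.succ), Fin.sum_univ_succ (fun i => (F i).K)]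
    push_cast
    ring

/-- Projection of a composition to its base graph. -/
def cproj (P : LGraph) (H : P.V → LGraph) (x : (P.comp H).V) : P.V := x.1

/-- Inclusion of a component in a composition. -/
def cinc (P : LGraph) (H : P.V → LGraph) (v : P.V) (a : (H v).V) : (P.comp H).V := ⟨v, a⟩

lemma K_comp (P : LGraph) (H : P.V → LGraph) :
    (P.comp H).K = kap P.sg (Finset.univ.filter fun v => Nonempty (H v).V) + ∑ v, (H v).K := by
  have h := kap_fibers P.sg (P.comp H).sg (cproj P H) _ Finset.univ rfl (by
    intro x _ y _ hne
    constructor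
    · rintro (⟨v, a, b, hx, hy, _⟩ | ⟨_, h⟩)
      · rw [hx, hy] at hne
        exact absurd rfl hne
      · exact h
    · intro h
      exact Or.inr ⟨hne, h⟩)
  have himg : (Finset.univ : Finset (P.comp H).V).image (cproj P H) =
      Finset.univ.filter fun v => Nonempty (H v).V := by
    ext v
    simp only [Finset.mem_image, Finset.mem_univ, true_and, Finset.mem_filter]
    constructor
    · rintro ⟨x, rfl⟩
      exact ⟨x.2⟩
    · rintro ⟨a⟩
      exact ⟨⟨v, a⟩, rfl⟩
  rw [himg] at h
  refine h.trans ?_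
  congr 1
  have h2 : ∀ v, kap (P.comp H).sg (Finset.univ.filter fun t => cproj P H t = v) = (H v).K := by
    intro v
    rw [← kap_image (H v) (P.comp H) (cinc P H v)
      (fun a b h => eq_of_heq (Sigma.mk.inj_iff.1 h).2) ?_]
    · congr 1
      ext t
      simp only [Finset.mem_filter, Finset.mem_univ, true_and, Finset.mem_image]
      constructor
      · rintro rfl
        exact ⟨t.2, rfl⟩
      · rintro ⟨b, rfl⟩
        rfl
    · intro a b
      constructor
      · intro hab
        exact Or.inl ⟨v, a, b, rfl, rfl, hab⟩
      · rintro (⟨w, a', b', ha, hb, hab⟩ | ⟨hne, _⟩)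
        · obtain ⟨rfl, ha⟩ := Sigma.mk.inj_iff.1 ha
          obtain ⟨_, hb⟩ := Sigma.mk.inj_iff.1 hb
          rw [eq_of_heq ha, eq_of_heq hb]
          exact hab
        · exact absurd rfl hne
  simp only [h2]
  refine Finset.sum_subset (Finset.subset_univ _) fun v _ hv => ?_
  simp only [Finset.mem_filter, Finset.mem_univ, true_and, not_nonempty_iff] at hv
  exact K_empty _ hv

lemma rule_p (n : ℕ) (P : LGraph) (e : P.V ≃ Fin n) (M N : Fin n → LGraph) (hn : 4 ≤ n)
    (hM : ∀ i, Nonempty (M i).V) :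
    ((P.dual.comp fun v => M (e v)).par (P.comp fun v => N (e v))).K ≤
      (bigTensor n fun i => (M i).par (N i)).K := by
  have hcard : (Finset.univ : Finset P.V).card = n := by
    rw [Finset.card_univ, Fintype.card_congr e, Fintype.card_fin]
  set S : Finset P.V := Finset.univ.filter fun v => Nonempty (N (e v)).V with hS
  have hprem : (bigTensor n fun i => (M i).par (N i)).K =
      ∑ i, (M i).K + ∑ i, (N i).K - S.card + (n - 1) := by
    obtain ⟨k, rfl⟩ : ∃ k, n = k + 1 := ⟨n - 1, by omega⟩
    rw [K_bigTensor k _ fun i => ⟨Sum.inl (hM i).some⟩]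
    have h1 : ∀ i, ((M i).par (N i)).K =
        (M i).K + (N i).K - (if Nonempty (N i).V then 1 else 0) := by
      intro i
      by_cases h : Nonempty (N i).V
      · rw [K_par _ _ (hM i) h, if_pos h]
      · rw [not_nonempty_iff] at h
        rw [K_par_empty _ _ h, K_empty _ h, if_neg (not_nonempty_iff.2 h)]
        ring
    have h2 : (S.card : ℝ) = ∑ i, (if Nonempty (N i).V then (1 : ℝ) else 0) := by
      rw [← Equiv.sum_comp e, hS, Finset.card_filter]
      push_cast
      rfl
    simp only [h1]
    rw [Finset.sum_sub_distrib, Finset.sum_add_distrib, ← h2]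
    push_cast
    ring
  have hD : (P.dual.comp fun v => M (e v)).K = - P.K + ∑ i, (M i).K := by
    rw [K_comp, ← Equiv.sum_comp e, ← K_dual]
    congr 2
    ext v
    simp [hM]
  have hN : (P.comp fun v => N (e v)).K = kap P.sg S + ∑ i, (N i).K := by
    rw [K_comp, ← Equiv.sum_comp e]
  have hp : Nonempty P.V := ⟨e.symm ⟨0, by omega⟩⟩
  rw [hprem]
  by_cases hSe : S.Nonempty
  · have hl := kap_subset P.sg S Finset.univ (Finset.subset_univ _) hSe
    rw [hcard, abs_le] at hl
    have ne1 : Nonempty (P.dual.comp fun v => M (e v)).V := by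
      obtain ⟨v⟩ := hp
      exact ⟨⟨v, (hM (e v)).some⟩⟩
    have ne2 : Nonempty (P.comp fun v => N (e v)).V := by
      obtain ⟨v, hv⟩ := hSe
      exact ⟨⟨v, (Finset.mem_filter.1 hv).2.some⟩⟩
    rw [K_par _ _ ne1 ne2, hD, hN]
    unfold LGraph.K at *
    linarith [hl.1]
  · have hNe : ∀ v, IsEmpty (N (e v)).V := by
      intro v
      by_contra h
      rw [not_isEmpty_iff] at h
      exact hSe ⟨v, Finset.mem_filter.2 ⟨Finset.mem_univ _, h⟩⟩
    have hz : ∑ i, (N i).K = 0 := by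
      rw [← Equiv.sum_comp e]
      exact Finset.sum_eq_zero fun v _ => K_empty _ (hNe v)
    have hem : IsEmpty (P.comp fun v => N (e v)).V := ⟨fun x => (hNe x.1).false x.2⟩
    rw [K_par_empty _ _ hem, hD, hz,
      Finset.not_nonempty_iff_eq_empty.1 hSe]
    obtain ⟨v⟩ := hp
    have hl := kap_subset P.sg {v} Finset.univ (Finset.subset_univ _) (Finset.singleton_nonempty v)
    rw [hcard, abs_le, kap_small _ {v} (by simp), Finset.card_singleton] at hl
    have hl1 := hl.1
    unfold LGraph.K at *
    push_cast at *
    simp only [Finset.card_empty, Nat.cast_zero]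
    linarith

lemma rule_sound {p c : LGraph} (h : GSRule p c) : Nonempty c.V ∧
    ((IsEmpty p.V ∧ c.K ≤ -1) ∨ (Nonempty p.V ∧ c.K ≤ p.K)) := by
  cases h with
  | ai a =>
    refine ⟨⟨Sum.inl ()⟩, Or.inl ⟨⟨fun x => x.elim⟩, ?_⟩⟩
    have : ((single (dualAtom a)).par (single a)).K = (pt.par pt).K := by
      refine K_equiv (pt.par pt) _ (Equiv.refl _) ?_
      rintro (x | x) (y | y) <;> exact Iff.rfl
    rw [this, K_par_pt]
  | ss A B S hA hS =>
    obtain ⟨b, hb⟩ := Set.nonempty_iff_ne_empty.2 hS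
    refine ⟨⟨Sum.inl b⟩, Or.inr ⟨⟨Sum.inl b⟩, ?_⟩⟩
    rw [K_par B A ⟨b⟩ hA, K_plug _ _ _ hA]
    have := K_plug_pt B S ⟨b⟩
    rw [abs_le] at this
    linarith [this.1]
  | p n P e M N hP hn hM =>
    refine ⟨⟨Sum.inl ⟨e.symm ⟨0, by omega⟩, ?_⟩⟩, Or.inr ⟨?_, rule_p n P e M N hn hM⟩⟩
    · exact (hM _).some
    · exact bigTensor_nonempty _ _ (by omega) fun i => ⟨Sum.inl (hM i).some⟩

lemma provable_sound {G : LGraph} (h : Provable GSRule G) : Nonempty G.V → G.K ≤ -1 := by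
  unfold Provable Deriv at h
  induction h with
  | refl => exact fun ⟨x⟩ => x.elim
  | tail _ hstep ih =>
    intro hne
    rcases hstep with hiso | ⟨C, R, p, c, hr, hG, hH⟩
    · rw [K_iso hiso]
      obtain ⟨e⟩ := hiso
      exact ih ⟨e.toEquiv.symm hne.some⟩
    · rw [← K_iso hH]
      have hKG := K_iso hG
      obtain ⟨e⟩ := hG
      obtain ⟨hc, hcase⟩ := rule_sound hr
      rw [K_plug _ _ _ hc]
      rcases hcase with ⟨hp, hK⟩ | ⟨hp, hK⟩
      · by_cases hC : Nonempty C.V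
        · have h1 := ih ⟨e.toEquiv.symm (Sum.inl hC.some)⟩
          rw [K_plug_empty _ _ _ hp] at hKG
          have h2 := K_plug_pt C R hC
          rw [abs_le] at h2
          linarith [h2.2]
        · have h0 : (C.plug R pt).K = 0 := by
            apply kap_small
            rw [Finset.card_le_one]
            rintro (x | x) _ (y | y) _
            · exact absurd ⟨x⟩ hC
            · exact absurd ⟨x⟩ hC
            · exact absurd ⟨y⟩ hC
            · rfl
          linarith
      · have h1 := ih ⟨e.toEquiv.symm (Sum.inr hp.some)⟩
        rw [K_plug _ _ _ hp] at hKG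
        linarith

end Final

/-- **Consistency.** If `G` is a non-empty graph that is provable in
GS, then its dual `Ḡ` is not provable in GS. -/
theorem consistency (G : LGraph) (hG : Nonempty G.V)
    (h : Provable GSRule G) : ¬ Provable GSRule G.dual := by
  intro h'
  have h1 := provable_sound h hG
  have h2 := provable_sound h' hG
  rw [K_dual] at h2
  linarith
end GSP
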